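/- For every utilization vector N and every heavy class ℓ ∈ H(N), the truncation retains almost all picked items: N^(2)_ℓ ≥ (1 − 2ε)·N_ℓ. -/

import Mathlib

open Finset
open scoped Classical

noncomputable section

namespace IK

variable {ι : Type*} [Fintype ι]

/-- `Wcl wgt ℓ a b = Σ_{j=a}^{b} w_{ℓ,j}`, the total weight of items `a,…,b` of class `ℓ`. -/
def Wcl (wgt : ι → ℕ → ℝ) (ℓ : ι) (a b : ℕ) : ℝ := ∑ j ∈ Finset.Icc a b, wgt ℓ j

/-- The set `H(N)` of classes that are heavy for `N` (here `e = 1/ε`). -/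
def heavy (e : ℕ) (N : ι → ℕ) : Finset ι := Finset.univ.filter fun ℓ => e < N ℓ

/-- `W_H(N)`, the weight picked by `N` from heavy classes beyond their first `1/ε` items. -/
def WH (wgt : ι → ℕ → ℝ) (e : ℕ) (N : ι → ℕ) : ℝ :=
  ∑ ℓ ∈ heavy e N, Wcl wgt ℓ (e + 1) (N ℓ)

/-- `P2[x]`: the least integer power of `2` that is `≥ x` for `x > 0`, and `0` for `x ≤ 0`. -/
def P2 (x : ℝ) : ℝ := if 0 < x then (2 : ℝ) ^ ⌈Real.logb 2 x⌉ else 0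

/-- The rounding unit `P2[(ε/|L|)·W_H(N)]`. -/
def base (ε : ℝ) (wgt : ι → ℕ → ℝ) (e : ℕ) (N : ι → ℕ) : ℝ :=
  P2 (ε / (Fintype.card ι) * WH wgt e N)

/-- The multiplier `μ_ℓ(N)`: the unique integer with
`(μ_ℓ(N)−1)·P2[(ε/|L|)·W_H(N)] < W_ℓ(1/ε+1, N_ℓ) ≤ μ_ℓ(N)·P2[(ε/|L|)·W_H(N)]`. -/
def mu (ε : ℝ) (wgt : ι → ℕ → ℝ) (e : ℕ) (N : ι → ℕ) (ℓ : ι) : ℤ :=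
  ⌈Wcl wgt ℓ (e + 1) (N ℓ) / base ε wgt e N⌉

/-- The over-estimate `E_ℓ(N) = μ_ℓ(N)·P2[(ε/|L|)·W_H(N)]`. -/
def Ecl (ε : ℝ) (wgt : ι → ℕ → ℝ) (e : ℕ) (N : ι → ℕ) (ℓ : ι) : ℝ :=
  (mu ε wgt e N ℓ : ℝ) * base ε wgt e N

/-- The up-rounding `N^(1)` of `N`: coordinates of light classes are kept, while each heavy
class picks `max{k ∈ [1/ε+1, n_ℓ] : W_ℓ(1/ε+1, k) ≤ E_ℓ(N)}` items. -/
def upround (ε : ℝ) (wgt : ι → ℕ → ℝ) (nI : ι → ℕ) (e : ℕ) (N : ι → ℕ) : ι → ℕ :=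
  fun ℓ =>
    if e < N ℓ then
      ((Finset.Icc (e + 1) (nI ℓ)).filter fun k => Wcl wgt ℓ (e + 1) k ≤ Ecl ε wgt e N ℓ).sup id
    else N ℓ

/-- `Δ_ℓ(N) = N^(1)_ℓ − 1/ε`. -/
def delta (ε : ℝ) (wgt : ι → ℕ → ℝ) (nI : ι → ℕ) (e : ℕ) (N : ι → ℕ) (ℓ : ι) : ℕ :=
  upround ε wgt nI e N ℓ - e

/-- The truncation `N^(2)` of `N`: coordinates of light classes are kept, while each heavy
class eliminates its last `⌈2ε·Δ_ℓ(N)⌉` items from `N^(1)`. -/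
def trunc (ε : ℝ) (wgt : ι → ℕ → ℝ) (nI : ι → ℕ) (e : ℕ) (N : ι → ℕ) : ι → ℕ :=
  fun ℓ =>
    if e < N ℓ then
      upround ε wgt nI e N ℓ - (⌈2 * ε * (delta ε wgt nI e N ℓ : ℝ)⌉).toNat
    else upround ε wgt nI e N ℓ

/-- The total weight `w(N) = Σ_ℓ W_ℓ(1, N_ℓ)` of a utilization vector. -/
def wtot (wgt : ι → ℕ → ℝ) (N : ι → ℕ) : ℝ := ∑ ℓ : ι, Wcl wgt ℓ 1 (N ℓ)

end IK

namespace IK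

theorem P2_pos {x : ℝ} (hx : 0 < x) : 0 < P2 x := by
  rw [P2, if_pos hx]
  positivity

theorem Wcl_pos {ι : Type*} {wgt : ι → ℕ → ℝ} {ℓ : ι} {a b : ℕ} (hab : a ≤ b)
    (hw : ∀ j ∈ Finset.Icc a b, 0 < wgt ℓ j) : 0 < Wcl wgt ℓ a b :=
  Finset.sum_pos hw (Finset.nonempty_Icc.2 hab)

theorem Wcl_heavy_pos {ι : Type*} [Fintype ι] {e : ℕ} {nI : ι → ℕ} {wgt : ι → ℕ → ℝ}
    {N : ι → ℕ} (hw0 : ∀ ℓ, ∀ j ∈ Finset.Icc 1 (nI ℓ), 0 < wgt ℓ j) (hN : ∀ ℓ, N ℓ ≤ nI ℓ)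
    {ℓ : ι} (hℓ : ℓ ∈ heavy e N) : 0 < Wcl wgt ℓ (e + 1) (N ℓ) := by
  have h : e < N ℓ := by simpa [heavy] using hℓ
  refine Wcl_pos h fun j hj => hw0 ℓ j ?_
  have := hN ℓ
  rw [Finset.mem_Icc] at hj ⊢
  omega

theorem base_pos {ι : Type*} [Fintype ι] {ε : ℝ} (hε0 : 0 < ε) {e : ℕ} {nI : ι → ℕ}
    {wgt : ι → ℕ → ℝ} {N : ι → ℕ} (hw0 : ∀ ℓ, ∀ j ∈ Finset.Icc 1 (nI ℓ), 0 < wgt ℓ j)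
    (hN : ∀ ℓ, N ℓ ≤ nI ℓ) (hH : (heavy e N).Nonempty) : 0 < base ε wgt e N := by
  have hcard : (0 : ℝ) < Fintype.card ι :=
    Nat.cast_pos.2 (Fintype.card_pos_iff.2 ⟨hH.choose⟩)
  exact P2_pos (mul_pos (div_pos hε0 hcard)
    (Finset.sum_pos (fun ℓ hℓ => Wcl_heavy_pos hw0 hN hℓ) hH))

theorem Wcl_le_Ecl {ι : Type*} [Fintype ι] {ε : ℝ} {e : ℕ} {wgt : ι → ℕ → ℝ} {N : ι → ℕ}
    (hb : 0 < base ε wgt e N) (ℓ : ι) : Wcl wgt ℓ (e + 1) (N ℓ) ≤ Ecl ε wgt e N ℓ :=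
  (div_le_iff₀ hb).1 (Int.le_ceil _)

theorem le_upround {ι : Type*} [Fintype ι] {ε : ℝ} (hε0 : 0 < ε) {e : ℕ} {nI : ι → ℕ}
    {wgt : ι → ℕ → ℝ} {N : ι → ℕ} (hw0 : ∀ ℓ, ∀ j ∈ Finset.Icc 1 (nI ℓ), 0 < wgt ℓ j)
    (hN : ∀ ℓ, N ℓ ≤ nI ℓ) (ℓ : ι) : N ℓ ≤ upround ε wgt nI e N ℓ := by
  unfold upround
  split_ifs with h
  · have hb : 0 < base ε wgt e N := base_pos hε0 hw0 hN ⟨ℓ, by simpa [heavy] using h⟩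
    exact Finset.le_sup (f := id)
      (Finset.mem_filter.2 ⟨Finset.mem_Icc.2 ⟨h, hN ℓ⟩, Wcl_le_Ecl hb ℓ⟩)
  · exact le_rfl

end IK

/-- For every utilization vector `N` and every heavy class `ℓ ∈ H(N)`, the
truncation retains almost all picked items: `N^(2)_ℓ ≥ (1 − 2ε)·N_ℓ`. -/
theorem stmt8 {ι : Type*} [Fintype ι] [Nonempty ι]
    (ε : ℝ) (e : ℕ) (hε0 : 0 < ε) (hε : ε < 1 / 4) (he : (e : ℝ) * ε = 1)
    (nI : ι → ℕ) (wgt : ι → ℕ → ℝ)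
    (hw0 : ∀ ℓ, ∀ j ∈ Finset.Icc 1 (nI ℓ), 0 < wgt ℓ j)
    (hwm : ∀ ℓ, ∀ j k : ℕ, 1 ≤ j → j ≤ k → k ≤ nI ℓ → wgt ℓ j ≤ wgt ℓ k)
    (N : ι → ℕ) (hN : ∀ ℓ, N ℓ ≤ nI ℓ) :
    ∀ ℓ ∈ IK.heavy e N, (1 - 2 * ε) * (N ℓ : ℝ) ≤ (IK.trunc ε wgt nI e N ℓ : ℝ) := by
  intro ℓ hℓ
  have h : e < N ℓ := by simpa [IK.heavy] using hℓ
  have hle := IK.le_upround (e := e) hε0 hw0 hN ℓ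
  simp only [IK.trunc, if_pos h, IK.delta]
  generalize IK.upround ε wgt nI e N ℓ = U at hle ⊢
  rw [Nat.cast_sub (h.le.trans hle)]
  have hNU : (N ℓ : ℝ) ≤ U := Nat.cast_le.2 hle
  have heU : (e : ℝ) ≤ U := Nat.cast_le.2 (h.le.trans hle)
  have hx : 0 ≤ 2 * ε * ((U : ℝ) - e) := mul_nonneg (by positivity) (sub_nonneg.2 heU)
  have hceil := Int.ceil_lt_add_one (2 * ε * ((U : ℝ) - e))
  have hcast : ((⌈2 * ε * ((U : ℝ) - e)⌉.toNat : ℕ) : ℝ) = ⌈2 * ε * ((U : ℝ) - e)⌉ :=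
    congrArg (Int.cast (R := ℝ)) (Int.toNat_of_nonneg (Int.ceil_nonneg hx))
  have hsub : (U : ℝ) ≤ ((U - ⌈2 * ε * ((U : ℝ) - e)⌉.toNat : ℕ) : ℝ) +
      (⌈2 * ε * ((U : ℝ) - e)⌉.toNat : ℕ) := mod_cast le_tsub_add
  have hmul : (1 - 2 * ε) * (N ℓ : ℝ) ≤ (1 - 2 * ε) * U :=
    mul_le_mul_of_nonneg_left hNU (by linarith)
  linarith
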